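/- arXiv:1204.3647 — 2 statements merged into one kernel-verified Lean document; each statement's English description precedes it below -/
import Mathlib

section
/- Let a and b be real numbers with 0 < a < b such that b/a is irrational. Then the series of lengths of the Euclidean firings converges, i.e., the function i ↦ l_i is summable, and its sum satisfies Σ_{i≥0} l_i ≤ 4·b. -/
/-- The Euclidean-algorithm pair sequence: `(a_i, b_i)` with `a_0 = a`, `b_0 = b`,
`a_{i+1} = b_i - ⌊b_i / a_i⌋ * a_i`, and `b_{i+1} = a_i`. -/
noncomputable def euclidPair (a b : ℝ) : ℕ → ℝ × ℝ
  | 0 => (a, b)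
  | i + 1 =>
    let p := euclidPair a b i
    (p.2 - (⌊p.2 / p.1⌋ : ℝ) * p.1, p.1)

/-- The remainder sequence `a_i` of the Euclidean algorithm. -/
noncomputable def aSeq (a b : ℝ) (i : ℕ) : ℝ := (euclidPair a b i).1

/-- The sequence `b_i` of the Euclidean algorithm. -/
noncomputable def bSeq (a b : ℝ) (i : ℕ) : ℝ := (euclidPair a b i).2

/-- The quotient sequence `n_i = ⌊b_i / a_i⌋`. -/
noncomputable def nSeq (a b : ℝ) (i : ℕ) : ℤ := ⌊bSeq a b i / aSeq a b i⌋

/-- The firing-length sequence `l_i = n_i * a_i`. -/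
noncomputable def lSeq (a b : ℝ) (i : ℕ) : ℝ := (nSeq a b i : ℝ) * aSeq a b i

theorem aSeq_succ (a b : ℝ) (i : ℕ) :
    aSeq a b (i + 1) = bSeq a b i - (nSeq a b i : ℝ) * aSeq a b i := rfl

theorem bSeq_succ (a b : ℝ) (i : ℕ) : bSeq a b (i + 1) = aSeq a b i := rfl

theorem aSeq_nonneg_and_bSeq_nonneg {a b : ℝ} (ha : 0 ≤ a) (hb : 0 ≤ b) (i : ℕ) :
    0 ≤ aSeq a b i ∧ 0 ≤ bSeq a b i := by
  induction i with
  | zero => exact ⟨ha, hb⟩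
  | succ i ih =>
    refine ⟨?_, ih.1⟩
    rw [aSeq_succ, sub_nonneg]
    rcases ih.1.eq_or_lt with h | h
    · simpa [← h] using ih.2
    · exact (le_div_iff₀ h).mp (Int.floor_le _)

theorem lSeq_nonneg {a b : ℝ} (ha : 0 ≤ a) (hb : 0 ≤ b) (i : ℕ) : 0 ≤ lSeq a b i := by
  obtain ⟨hai, hbi⟩ := aSeq_nonneg_and_bSeq_nonneg ha hb i
  exact mul_nonneg (Int.cast_nonneg (Int.floor_nonneg.mpr (div_nonneg hbi hai))) hai

theorem sum_range_lSeq (a b : ℝ) (n : ℕ) :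
    ∑ i ∈ Finset.range n, lSeq a b i = a + b - (aSeq a b n + bSeq a b n) := by
  induction n with
  | zero => simp [aSeq, bSeq, euclidPair]
  | succ n ih =>
    rw [Finset.sum_range_succ, ih, aSeq_succ, bSeq_succ, lSeq]
    ring

theorem euclid_lengths_summable (a b : ℝ) (ha : 0 < a) (hab : a < b)
    (hirr : Irrational (b / a)) :
    Summable (fun i : ℕ => lSeq a b i) ∧ (∑' i : ℕ, lSeq a b i) ≤ 4 * b := by
  have hl : ∀ i, 0 ≤ lSeq a b i := lSeq_nonneg ha.le (ha.trans hab).le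
  have hsum : ∀ n, ∑ i ∈ Finset.range n, lSeq a b i ≤ 4 * b := fun n ↦ by
    obtain ⟨han, hbn⟩ := aSeq_nonneg_and_bSeq_nonneg ha.le (ha.trans hab).le n
    rw [sum_range_lSeq]
    linarith
  exact ⟨summable_of_sum_range_le hl hsum, Real.tsum_le_of_sum_range_le hl hsum⟩
end

section
/- Let a and b be real numbers with 0 < a < b such that b/a is irrational. Then the total length of all Euclidean firings equals a + b: the function i ↦ l_i is summable and Σ_{i≥0} l_i = a + b. -/
open Filter Topology in
theorem tendsto_zero_of_add_le {s : ℕ → ℝ} (h0 : ∀ i, 0 ≤ s i)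
    (h : ∀ i, s (i + 1) + s (i + 2) ≤ s i) : Tendsto s atTop (𝓝 0) := by
  have hanti : Antitone s := antitone_nat_of_succ_le fun i => by linarith [h i, h0 (i + 2)]
  have hlim := tendsto_atTop_ciInf hanti ⟨0, by rintro _ ⟨i, rfl⟩; exact h0 i⟩
  have hle := le_of_tendsto_of_tendsto' (((tendsto_add_atTop_iff_nat 1).2 hlim).add
    ((tendsto_add_atTop_iff_nat 2).2 hlim)) hlim h
  have hzero : ⨅ i, s i = 0 := le_antisymm (by linarith) (le_ciInf h0)
  rwa [hzero] at hlim

theorem lSeq_eq_bSeq_sub (a b : ℝ) (i : ℕ) : lSeq a b i = bSeq a b i - aSeq a b (i + 1) := by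
  simp [lSeq, nSeq, aSeq, bSeq, euclidPair]

theorem aSeq_succ_eq_fract_mul {a b : ℝ} {i : ℕ} (h : aSeq a b i ≠ 0) :
    aSeq a b (i + 1) = Int.fract (bSeq a b i / aSeq a b i) * aSeq a b i := by
  rw [Int.fract, sub_mul, div_mul_cancel₀ _ h]
  rfl

theorem euclid_invariant {a b : ℝ} (ha : 0 < a) (hab : a < b) (hirr : Irrational (b / a))
    (i : ℕ) : 0 < aSeq a b i ∧ aSeq a b i < bSeq a b i ∧
      Irrational (bSeq a b i / aSeq a b i) := by
  induction i with
  | zero => exact ⟨ha, hab, hirr⟩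
  | succ i ih =>
    obtain ⟨hpos, -, hirr⟩ := ih
    have hfract : Irrational (Int.fract (bSeq a b i / aSeq a b i)) := hirr.sub_intCast _
    have hfract_pos := (Int.fract_nonneg _).lt_of_ne' hfract.ne_zero
    rw [bSeq_succ, aSeq_succ_eq_fract_mul hpos.ne']
    refine ⟨mul_pos hfract_pos hpos, mul_lt_of_lt_one_left hpos (Int.fract_lt_one _), ?_⟩
    rw [div_mul_cancel_right₀ hpos.ne']
    exact hfract.inv

theorem aSeq_le_lSeq {a b : ℝ} {i : ℕ} (hpos : 0 < aSeq a b i) (hlt : aSeq a b i < bSeq a b i) :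
    aSeq a b i ≤ lSeq a b i := by
  have hn : 1 ≤ nSeq a b i := Int.le_floor.2 (by simpa using ((one_lt_div hpos).2 hlt).le)
  exact le_mul_of_one_le_left hpos.le (by exact_mod_cast hn)

theorem euclid_total_length (a b : ℝ) (ha : 0 < a) (hab : a < b)
    (hirr : Irrational (b / a)) :
    Summable (fun i : ℕ => lSeq a b i) ∧ (∑' i : ℕ, lSeq a b i) = a + b := by
  have inv := euclid_invariant ha hab hirr
  have hl : ∀ i, aSeq a b i ≤ lSeq a b i := fun i => aSeq_le_lSeq (inv i).1 (inv i).2.1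
  have hlim := tendsto_zero_of_add_le (s := fun i => aSeq a b i + bSeq a b i)
    (fun i => by linarith [(inv i).1, (inv i).2.1]) (fun i => by
      have h₀ := hl i
      have h₁ := hl (i + 1)
      rw [lSeq_eq_bSeq_sub] at h₀ h₁
      simp only [bSeq_succ] at h₀ h₁ ⊢
      linarith)
  have hsum : ∀ n, ∑ i ∈ Finset.range n, lSeq a b i =
      a + b - (aSeq a b n + bSeq a b n) := fun n => by
    induction n with
    | zero => simp [aSeq, bSeq, euclidPair]
    | succ n ih =>
      rw [Finset.sum_range_succ, ih, lSeq_eq_bSeq_sub, bSeq_succ]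
      ring
  have hhas : HasSum (fun i => lSeq a b i) (a + b) := by
    rw [hasSum_iff_tendsto_nat_of_nonneg fun i => (inv i).1.le.trans (hl i)]
    simp only [hsum]
    simpa using hlim.const_sub (a + b)
  exact ⟨hhas.summable, hhas.tsum_eq⟩
end
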